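/- arXiv:2410.10598 — 2 statements merged into one kernel-verified Lean document; each statement's English description precedes it below -/
import Mathlib

section
/- For all n ≥ 2, there exist polynomials P, Q ∈ ℤ[x,y] with total degree of P at most n − 3 and total degree of Q at most n − 1 such that Y_n = y^n − n·x²·y^{n−2} + x³·P + Q. -/
open MvPolynomial

/-- The first coordinates `X_n ∈ ℤ[x,y]` of the folding maps `B_n = 𝖥_n[𝓑₂]`
(with `X 0 = x`, `X 1 = y`): `X_0 = 4`, `X_1 = x`, `X_2 = x²−2y−4`,
`X_3 = x³−3xy−3x`, and `X_{n+4} = x(X_{n+3}+X_{n+1}) − (2+y)X_{n+2} − X_n`. -/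
noncomputable def XB : ℕ → MvPolynomial (Fin 2) ℤ
  | 0 => 4
  | 1 => X 0
  | 2 => X 0 ^ 2 - 2 * X 1 - 4
  | 3 => X 0 ^ 3 - 3 * X 0 * X 1 - 3 * X 0
  | n + 4 => X 0 * (XB (n + 3) + XB (n + 1)) - (2 + X 1) * XB (n + 2) - XB n

/-- The second coordinates `Y_n ∈ ℤ[x,y]` of the folding maps `B_n = 𝖥_n[𝓑₂]`
(with `X 0 = x`, `X 1 = y`): `Y_0 = 4`, `Y_1 = y`, `Y_2 = y²−2x²+4y+4`,
`Y_3 = y³−3x²y+6y²+9y`, and `Y_{n+4} = y(Y_{n+3}+Y_{n+1}) − (x²−2y−2)Y_{n+2} − Y_n`. -/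
noncomputable def YB : ℕ → MvPolynomial (Fin 2) ℤ
  | 0 => 4
  | 1 => X 1
  | 2 => X 1 ^ 2 - 2 * X 0 ^ 2 + 4 * X 1 + 4
  | 3 => X 1 ^ 3 - 3 * X 0 ^ 2 * X 1 + 6 * X 1 ^ 2 + 9 * X 1
  | n + 4 => X 1 * (YB (n + 3) + YB (n + 1)) - (X 0 ^ 2 - 2 * X 1 - 2) * YB (n + 2) - YB n

section DegreeBounds

variable {p q : MvPolynomial (Fin 2) ℤ} {m n k : ℕ}

theorem totalDegree_add_le_of_le (hp : p.totalDegree ≤ k) (hq : q.totalDegree ≤ k) :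
    (p + q).totalDegree ≤ k :=
  (totalDegree_add p q).trans (max_le hp hq)

theorem totalDegree_sub_le_of_le (hp : p.totalDegree ≤ k) (hq : q.totalDegree ≤ k) :
    (p - q).totalDegree ≤ k :=
  (totalDegree_sub p q).trans (max_le hp hq)

theorem totalDegree_mul_le_of_le (hp : p.totalDegree ≤ m) (hq : q.totalDegree ≤ n)
    (h : m + n ≤ k) : (p * q).totalDegree ≤ k :=
  (totalDegree_mul p q).trans ((add_le_add hp hq).trans h)

theorem totalDegree_X_pow_le (i : Fin 2) (h : n ≤ k) :
    ((X i : MvPolynomial (Fin 2) ℤ) ^ n).totalDegree ≤ k :=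
  (totalDegree_X_pow i n).trans_le h

theorem totalDegree_X_le (i : Fin 2) (h : 1 ≤ k) :
    (X i : MvPolynomial (Fin 2) ℤ).totalDegree ≤ k :=
  (totalDegree_X i).trans_le h

theorem totalDegree_C_le (c : ℤ) : (C c : MvPolynomial (Fin 2) ℤ).totalDegree ≤ k :=
  (totalDegree_C c).trans_le (Nat.zero_le k)

theorem totalDegree_ofNat_le (c : ℕ) [c.AtLeastTwo] :
    (OfNat.ofNat c : MvPolynomial (Fin 2) ℤ).totalDegree ≤ k := by
  simpa using totalDegree_C_le (k := k) (OfNat.ofNat c : ℤ)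

end DegreeBounds

theorem totalDegree_YB_le : ∀ n, (YB n).totalDegree ≤ n
  | 0 => by
    rw [YB]
    exact totalDegree_ofNat_le 4
  | 1 => by
    rw [YB]
    exact totalDegree_X_le 1 le_rfl
  | 2 => by
    rw [YB]
    refine totalDegree_add_le_of_le (totalDegree_add_le_of_le (totalDegree_sub_le_of_le ?_ ?_) ?_)
      (totalDegree_ofNat_le 4)
    · exact totalDegree_X_pow_le 1 le_rfl
    · exact totalDegree_mul_le_of_le (totalDegree_ofNat_le 2) (totalDegree_X_pow_le 0 le_rfl)
        (zero_add 2).le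
    · exact totalDegree_mul_le_of_le (totalDegree_ofNat_le 4) (totalDegree_X_le 1 one_le_two)
        (zero_add 2).le
  | 3 => by
    rw [YB]
    refine totalDegree_add_le_of_le (totalDegree_add_le_of_le (totalDegree_sub_le_of_le ?_ ?_) ?_) ?_
    · exact totalDegree_X_pow_le 1 le_rfl
    · refine totalDegree_mul_le_of_le (m := 2) ?_ (totalDegree_X_le 1 le_rfl) le_rfl
      exact totalDegree_mul_le_of_le (totalDegree_ofNat_le 3) (totalDegree_X_pow_le 0 le_rfl)
        (zero_add 2).le
    · exact totalDegree_mul_le_of_le (totalDegree_ofNat_le 6) (totalDegree_X_pow_le 1 le_rfl)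
        (by lia : 0 + 2 ≤ 3)
    · exact totalDegree_mul_le_of_le (totalDegree_ofNat_le 9) (totalDegree_X_le 1 le_rfl)
        (by lia : 0 + 1 ≤ 3)
  | n + 4 => by
    have h₀ := totalDegree_YB_le n
    have h₁ := totalDegree_YB_le (n + 1)
    have h₂ := totalDegree_YB_le (n + 2)
    have h₃ := totalDegree_YB_le (n + 3)
    rw [YB]
    refine totalDegree_sub_le_of_le (totalDegree_sub_le_of_le ?_ ?_) (h₀.trans (by lia))
    · exact totalDegree_mul_le_of_le (totalDegree_X_le 1 le_rfl)
        (totalDegree_add_le_of_le h₃ (h₁.trans (by lia))) (by lia)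
    · refine totalDegree_mul_le_of_le (m := 2) ?_ h₂ (by lia)
      exact totalDegree_sub_le_of_le (totalDegree_sub_le_of_le (totalDegree_X_pow_le 0 le_rfl)
        (totalDegree_mul_le_of_le (totalDegree_ofNat_le 2) (totalDegree_X_le 1 le_rfl)
          (by lia : 0 + 1 ≤ 2)))
        (totalDegree_ofNat_le 2)

/-- The bound on `X 0 ^ 2 * P` forces `P = 0` when `m = 0`, where the bound on `P` alone is
too weak for the recursion. -/
theorem YB_add_two_leading_terms : ∀ m : ℕ, ∃ P Q : MvPolynomial (Fin 2) ℤ,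
    P.totalDegree ≤ m - 1 ∧ (X 0 ^ 2 * P).totalDegree ≤ m + 1 ∧ Q.totalDegree ≤ m + 1 ∧
      YB (m + 2) = X 1 ^ (m + 2) - C ((m + 2 : ℕ) : ℤ) * X 0 ^ 2 * X 1 ^ m + X 0 ^ 3 * P + Q
  | 0 => by
    refine ⟨0, 4 * X 1 + 4, by simp, by simp, ?_, ?_⟩
    · exact totalDegree_add_le_of_le
        (totalDegree_mul_le_of_le (totalDegree_ofNat_le 4) (totalDegree_X_le 1 le_rfl) le_rfl)
        (totalDegree_ofNat_le 4)
    · simp [YB]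
      ring
  | 1 => by
    refine ⟨0, 6 * X 1 ^ 2 + 9 * X 1, by simp, by simp, ?_, ?_⟩
    · exact totalDegree_add_le_of_le
        (totalDegree_mul_le_of_le (totalDegree_ofNat_le 6) (totalDegree_X_pow_le 1 le_rfl) le_rfl)
        (totalDegree_mul_le_of_le (totalDegree_ofNat_le 9) (totalDegree_X_le 1 le_rfl)
          (by lia : 0 + 1 ≤ 2))
    · simp [YB]
      ring
  | k + 2 => by
    obtain ⟨P₂, Q₂, -, hxP₂, hQ₂, h₂⟩ := YB_add_two_leading_terms k
    obtain ⟨P₃, Q₃, hP₃, -, hQ₃, h₃⟩ := YB_add_two_leading_terms (k + 1)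
    have hP : (X 1 * P₃ + C ((k + 2 : ℕ) : ℤ) * (X 0 * X 1 ^ k) - X 0 ^ 2 * P₂).totalDegree
        ≤ k + 1 := by
      refine totalDegree_sub_le_of_le (totalDegree_add_le_of_le ?_ ?_) hxP₂
      · exact totalDegree_mul_le_of_le (totalDegree_X_le 1 le_rfl) hP₃ (by lia)
      · refine totalDegree_mul_le_of_le (n := k + 1) (totalDegree_C_le _) ?_ (zero_add _).le
        exact totalDegree_mul_le_of_le (totalDegree_X_le 0 le_rfl) (totalDegree_X_pow_le 1 le_rfl)
          (by lia)
    refine ⟨_, X 1 * Q₃ - X 0 ^ 2 * Q₂ + X 1 * YB (k + 1) + (2 * X 1 + 2) * YB (k + 2) - YB k,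
      hP, totalDegree_mul_le_of_le (totalDegree_X_pow_le 0 le_rfl) hP (by lia), ?_, ?_⟩
    · refine totalDegree_sub_le_of_le (totalDegree_add_le_of_le (totalDegree_add_le_of_le
        (totalDegree_sub_le_of_le ?_ ?_) ?_) ?_) ((totalDegree_YB_le k).trans (by lia))
      · exact totalDegree_mul_le_of_le (totalDegree_X_le 1 le_rfl) hQ₃ (by lia)
      · exact totalDegree_mul_le_of_le (totalDegree_X_pow_le 0 le_rfl) hQ₂ (by lia)
      · exact totalDegree_mul_le_of_le (totalDegree_X_le 1 le_rfl) (totalDegree_YB_le _) (by lia)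
      · refine totalDegree_mul_le_of_le (m := 1) ?_ (totalDegree_YB_le _) (by lia)
        exact totalDegree_add_le_of_le
          (totalDegree_mul_le_of_le (totalDegree_ofNat_le 2) (totalDegree_X_le 1 le_rfl) le_rfl)
          (totalDegree_ofNat_le 2)
    · have h₄ : YB (k + 2 + 2) = X 1 * YB (k + 3) - X 0 ^ 2 * YB (k + 2) + X 1 * YB (k + 1)
          + (2 * X 1 + 2) * YB (k + 2) - YB k := by
        rw [YB]
        ring
      have h₃' : YB (k + 3) = _ := h₃
      rw [h₄, h₃']
      push_cast at h₂ ⊢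
      simp only [map_add, map_natCast, map_ofNat, map_one] at h₂ ⊢
      linear_combination (-X 0 ^ 2) * h₂

/-- For `n ≥ 2`, `Y_n = y^n − n x² y^{n−2} + x³·P + Q` with
`totalDegree P ≤ n − 3` and `totalDegree Q ≤ n − 1`. -/
theorem YB_leading_terms (n : ℕ) (hn : 2 ≤ n) :
    ∃ P Q : MvPolynomial (Fin 2) ℤ,
      P.totalDegree ≤ n - 3 ∧ Q.totalDegree ≤ n - 1 ∧
      YB n = X 1 ^ n - C (n : ℤ) * X 0 ^ 2 * X 1 ^ (n - 2) + X 0 ^ 3 * P + Q := by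
  obtain ⟨m, rfl⟩ := Nat.exists_eq_add_of_le' hn
  obtain ⟨P, Q, hP, -, hQ, h⟩ := YB_add_two_leading_terms m
  exact ⟨P, Q, hP.trans (by lia), hQ, h⟩
end

section
/- For all n ≥ 5, the polynomial X_n − ( x^n − n·x^{n−2}·y + ((n²−3n)/2)·x^{n−4}·y² − n·x^{n−3}·y − 3n·x^{n−2} ) in ℤ[x,y] has total degree at most n − 3. -/
open MvPolynomial

set_option maxHeartbeats 1000000

/-- The first coordinates `X_n ∈ ℤ[x,y]` of the folding maps `G_n = 𝖥_n[𝒢₂]`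
(with `X 0 = x`, `X 1 = y`), given by the initial values `X_0,…,X_5` and the recursion
`X_{n+6} = x(X_{n+5}+X_{n+1}) − (x+y+3)(X_{n+4}+X_{n+2}) + (x²−2y−4)X_{n+3} − X_n`. -/
noncomputable def XG : ℕ → MvPolynomial (Fin 2) ℤ
  | 0 => 6
  | 1 => X 0
  | 2 => X 0 ^ 2 - 2 * X 0 - 2 * X 1 - 6
  | 3 => X 0 ^ 3 - 3 * X 0 * X 1 - 9 * X 0 - 6 * X 1 - 12
  | 4 => X 0 ^ 4 - 4 * X 0 ^ 2 * X 1 - 10 * X 0 ^ 2 - 4 * X 0 * X 1 + 2 * X 1 ^ 2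
      - 8 * X 0 + 8 * X 1 + 6
  | 5 => X 0 ^ 5 - 5 * X 0 ^ 3 * X 1 - 15 * X 0 ^ 3 - 5 * X 0 ^ 2 * X 1
      + 5 * X 0 * X 1 ^ 2 - 10 * X 0 ^ 2 + 35 * X 0 * X 1 + 10 * X 1 ^ 2
      + 55 * X 0 + 50 * X 1 + 60
  | n + 6 => X 0 * (XG (n + 5) + XG (n + 1)) - (X 0 + X 1 + 3) * (XG (n + 4) + XG (n + 2))
      + (X 0 ^ 2 - 2 * X 1 - 4) * XG (n + 3) - XG n

/-- The second coordinates `Y_n ∈ ℤ[x,y]` of the folding maps `G_n = 𝖥_n[𝒢₂]`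
(with `X 0 = x`, `X 1 = y`), given by the initial values `Y_0,…,Y_5` and the recursion
`Y_{n+6} = y(Y_{n+5}+Y_{n+1}) − (x³−3xy−9x−5y−9)(Y_{n+4}+Y_{n+2})
+ (y²−2x³+6xy+18x+12y+8)Y_{n+3} − Y_n`. -/
noncomputable def YG : ℕ → MvPolynomial (Fin 2) ℤ
  | 0 => 6
  | 1 => X 1
  | 2 => -2 * X 0 ^ 3 + 6 * X 0 * X 1 + X 1 ^ 2 + 18 * X 0 + 10 * X 1 + 18
  | 3 => -3 * X 0 ^ 3 * X 1 - 6 * X 0 ^ 3 + 9 * X 0 * X 1 ^ 2 + X 1 ^ 3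
      + 45 * X 0 * X 1 + 18 * X 1 ^ 2 + 54 * X 0 + 63 * X 1 + 60
  | 4 => 2 * X 0 ^ 6 - 12 * X 0 ^ 4 * X 1 - 4 * X 0 ^ 3 * X 1 ^ 2 - 36 * X 0 ^ 4
      - 28 * X 0 ^ 3 * X 1 + 18 * X 0 ^ 2 * X 1 ^ 2 + 12 * X 0 * X 1 ^ 3 + X 1 ^ 4
      - 40 * X 0 ^ 3 + 108 * X 0 ^ 2 * X 1 + 120 * X 0 * X 1 ^ 2 + 24 * X 1 ^ 3
      + 162 * X 0 ^ 2 + 372 * X 0 * X 1 + 134 * X 1 ^ 2 + 360 * X 0 + 280 * X 1 + 198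
  | 5 => 5 * X 0 ^ 6 * X 1 + 10 * X 0 ^ 6 - 30 * X 0 ^ 4 * X 1 ^ 2 - 5 * X 0 ^ 3 * X 1 ^ 3
      - 150 * X 0 ^ 4 * X 1 - 65 * X 0 ^ 3 * X 1 ^ 2 + 45 * X 0 ^ 2 * X 1 ^ 3
      + 15 * X 0 * X 1 ^ 4 + X 1 ^ 5 - 180 * X 0 ^ 4 - 205 * X 0 ^ 3 * X 1
      + 360 * X 0 ^ 2 * X 1 ^ 2 + 240 * X 0 * X 1 ^ 3 + 30 * X 1 ^ 4 - 190 * X 0 ^ 3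
      + 945 * X 0 ^ 2 * X 1 + 1200 * X 0 * X 1 ^ 2 + 255 * X 1 ^ 3 + 810 * X 0 ^ 2
      + 2415 * X 0 * X 1 + 920 * X 1 ^ 2 + 1710 * X 0 + 1495 * X 1 + 900
  | n + 6 => X 1 * (YG (n + 5) + YG (n + 1))
      - (X 0 ^ 3 - 3 * X 0 * X 1 - 9 * X 0 - 5 * X 1 - 9) * (YG (n + 4) + YG (n + 2))
      + (X 1 ^ 2 - 2 * X 0 ^ 3 + 6 * X 0 * X 1 + 18 * X 0 + 12 * X 1 + 8) * YG (n + 3)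
      - YG n

lemma totalDegree_mul_le_add {σ R : Type*} [CommRing R] {p q : MvPolynomial σ R} {a b : ℕ}
    (hp : p.totalDegree ≤ a) (hq : q.totalDegree ≤ b) : (p * q).totalDegree ≤ a + b :=
  (totalDegree_mul p q).trans (add_le_add hp hq)

lemma totalDegree_add_le_max {σ R : Type*} [CommRing R] {p q : MvPolynomial σ R} {a b : ℕ}
    (hp : p.totalDegree ≤ a) (hq : q.totalDegree ≤ b) : (p + q).totalDegree ≤ max a b :=
  (totalDegree_add p q).trans (max_le_max hp hq)

lemma totalDegree_sub_le_max {σ R : Type*} [CommRing R] {p q : MvPolynomial σ R} {a b : ℕ}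
    (hp : p.totalDegree ≤ a) (hq : q.totalDegree ≤ b) : (p - q).totalDegree ≤ max a b :=
  (totalDegree_sub p q).trans (max_le_max hp hq)

lemma totalDegree_ofNat_le_s8 {σ R : Type*} [CommRing R] (k : ℕ) [k.AtLeastTwo] :
    (OfNat.ofNat k : MvPolynomial σ R).totalDegree ≤ 0 := by
  rw [← map_ofNat (C (σ := σ) (R := R)) k, totalDegree_C]

lemma totalDegree_X_pow_le_s8 {σ R : Type*} [CommRing R] [Nontrivial R] (i : σ) (k : ℕ) :
    (X i ^ k : MvPolynomial σ R).totalDegree ≤ k := (totalDegree_X_pow i k).le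

lemma totalDegree_X_le_s8 {σ R : Type*} [CommRing R] [Nontrivial R] (i : σ) :
    (X i : MvPolynomial σ R).totalDegree ≤ 1 := (totalDegree_X i).le

lemma totalDegree_C_le_s8 {σ R : Type*} [CommRing R] (c : R) :
    (C c : MvPolynomial σ R).totalDegree ≤ 0 := (totalDegree_C c).le

/-- The coefficient of `x ^ (n + 1) * y ^ 2` in `X_{n+5}`. -/
def coeffXG (n : ℕ) : ℤ := (((n + 5 : ℕ) : ℤ) ^ 2 - 3 * ((n + 5 : ℕ) : ℤ)) / 2

lemma coeffXG_succ (n : ℕ) : coeffXG (n + 1) = coeffXG n + (n + 4) := by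
  unfold coeffXG
  rw [← Int.add_mul_ediv_right _ _ two_ne_zero]
  congr 1
  push_cast
  ring

/-- The part of `X_{n+5}` of degree at least `n + 3`. -/
noncomputable def topXG (n : ℕ) : MvPolynomial (Fin 2) ℤ :=
  X 0 ^ (n + 5) - C (n + 5 : ℤ) * X 0 ^ (n + 3) * X 1 + C (coeffXG n) * X 0 ^ (n + 1) * X 1 ^ 2
    - C (n + 5 : ℤ) * X 0 ^ (n + 2) * X 1 - C (3 * (n + 5) : ℤ) * X 0 ^ (n + 3)

/-- The part of `X_{n+3}` of degree at least `n + 2`. -/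
noncomputable def topTwoXG (n : ℕ) : MvPolynomial (Fin 2) ℤ :=
  X 0 ^ (n + 3) - C (n + 3 : ℤ) * X 0 ^ (n + 1) * X 1

lemma totalDegree_XG_sub_topTwoXG {n : ℕ}
    (h : ∀ m, m + 2 = n → (XG (m + 5) - topXG m).totalDegree ≤ m + 2) :
    (XG (n + 3) - topTwoXG n).totalDegree ≤ n + 1 := by
  match n with
  | 0 =>
    have e : XG (0 + 3) - topTwoXG 0 = C (-9) * X 0 - 6 * X 1 - 12 := by
      simp [XG, topTwoXG]
      ring
    rw [e]
    apply le_trans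
    · with_reducible_and_instances repeat' first
        | assumption
        | exact totalDegree_ofNat_le_s8 _
        | exact totalDegree_C_le_s8 _
        | exact totalDegree_X_le_s8 _
        | exact totalDegree_X_pow_le_s8 _ _
        | apply totalDegree_mul_le_add
        | apply totalDegree_add_le_max
        | apply totalDegree_sub_le_max
    · omega
  | 1 =>
    have e : XG (1 + 3) - topTwoXG 1 = 2 * X 1 ^ 2 - 10 * X 0 ^ 2 - 4 * X 0 * X 1
        - 8 * X 0 + 8 * X 1 + 6 := by
      simp [XG, topTwoXG]
      ring
    rw [e]
    apply le_trans
    · with_reducible_and_instances repeat' first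
        | assumption
        | exact totalDegree_ofNat_le_s8 _
        | exact totalDegree_C_le_s8 _
        | exact totalDegree_X_le_s8 _
        | exact totalDegree_X_pow_le_s8 _ _
        | apply totalDegree_mul_le_add
        | apply totalDegree_add_le_max
        | apply totalDegree_sub_le_max
    · omega
  | m + 2 =>
    have hm := h m rfl
    have e : XG (m + 5) - topTwoXG (m + 2) = (XG (m + 5) - topXG m)
        + (C (coeffXG m) * X 0 ^ (m + 1) * X 1 ^ 2
          - C (m + 5 : ℤ) * X 0 ^ (m + 2) * X 1 - C (3 * (m + 5) : ℤ) * X 0 ^ (m + 3)) := by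
      simp only [topTwoXG, topXG, Nat.cast_add, Nat.cast_ofNat, map_add, map_ofNat]
      ring
    rw [e]
    apply le_trans
    · with_reducible_and_instances repeat' first
        | assumption
        | exact totalDegree_ofNat_le_s8 _
        | exact totalDegree_C_le_s8 _
        | exact totalDegree_X_le_s8 _
        | exact totalDegree_X_pow_le_s8 _ _
        | apply totalDegree_mul_le_add
        | apply totalDegree_add_le_max
        | apply totalDegree_sub_le_max
    · omega

lemma totalDegree_XG_le (n : ℕ)
    (h : ∀ m, m + 5 ≤ n → (XG (m + 5) - topXG m).totalDegree ≤ m + 2) :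
    (XG n).totalDegree ≤ n := by
  match n with
  | 0 =>
    rw [XG]
    exact totalDegree_ofNat_le_s8 6
  | 1 =>
    rw [XG]
    exact totalDegree_X_le_s8 0
  | 2 =>
    rw [XG]
    apply le_trans
    · with_reducible_and_instances repeat' first
        | assumption
        | exact totalDegree_ofNat_le_s8 _
        | exact totalDegree_C_le_s8 _
        | exact totalDegree_X_le_s8 _
        | exact totalDegree_X_pow_le_s8 _ _
        | apply totalDegree_mul_le_add
        | apply totalDegree_add_le_max
        | apply totalDegree_sub_le_max
    · omega
  | n + 3 =>
    have hn := totalDegree_XG_sub_topTwoXG (n := n) fun m hm ↦ h m (by omega)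
    rw [← sub_add_cancel (XG (n + 3)) (topTwoXG n)]
    refine (totalDegree_add_le_max hn (q := topTwoXG n) (b := n + 3) ?_).trans (by omega)
    unfold topTwoXG
    apply le_trans
    · with_reducible_and_instances repeat' first
        | assumption
        | exact totalDegree_ofNat_le_s8 _
        | exact totalDegree_C_le_s8 _
        | exact totalDegree_X_le_s8 _
        | exact totalDegree_X_pow_le_s8 _ _
        | apply totalDegree_mul_le_add
        | apply totalDegree_add_le_max
        | apply totalDegree_sub_le_max
    · omega

lemma XG_add_six_sub_topXG (n : ℕ) :
    XG (n + 6) - topXG (n + 1) = X 0 * (XG (n + 5) - topXG n)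
      - (X 0 + X 1) * (XG (n + 4) - topTwoXG (n + 1)) - 3 * (XG (n + 4) - topTwoXG (n + 1))
      + (X 0 ^ 2 - 2 * X 1 - 4) * (XG (n + 3) - topTwoXG n)
      - (X 0 + X 1 + 3) * XG (n + 2) + X 0 * XG (n + 1) - XG n
      + C (3 * (n + 4) : ℤ) * X 0 ^ (n + 2) * X 1 - 4 * X 0 ^ (n + 3)
      + C (n + 3 : ℤ) * (2 * X 1 + 4) * X 0 ^ (n + 1) * X 1 := by
  rw [XG]
  simp only [topTwoXG, topXG, coeffXG_succ, Nat.cast_add, Nat.cast_one, map_add, map_mul,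
    map_ofNat, map_one]
  ring

lemma totalDegree_XG_sub_topXG (n : ℕ) : (XG (n + 5) - topXG n).totalDegree ≤ n + 2 := by
  induction n using Nat.strong_induction_on with
  | _ n ih =>
  match n with
  | 0 =>
    have e : XG (0 + 5) - topXG 0 = 35 * X 0 * X 1 + 10 * X 1 ^ 2 - 10 * X 0 ^ 2
        + 55 * X 0 + 50 * X 1 + 60 := by
      simp [XG, topXG, coeffXG]
      ring
    rw [e]
    apply le_trans
    · with_reducible_and_instances repeat' first
        | assumption
        | exact totalDegree_ofNat_le_s8 _
        | exact totalDegree_C_le_s8 _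
        | exact totalDegree_X_le_s8 _
        | exact totalDegree_X_pow_le_s8 _ _
        | apply totalDegree_mul_le_add
        | apply totalDegree_add_le_max
        | apply totalDegree_sub_le_max
    · omega
  | n + 1 =>
    have h5 := ih n (by omega)
    have h4 : (XG (n + 4) - topTwoXG (n + 1)).totalDegree ≤ n + 2 :=
      totalDegree_XG_sub_topTwoXG fun m hm ↦ ih m (by omega)
    have h3 := totalDegree_XG_sub_topTwoXG (n := n) fun m hm ↦ ih m (by omega)
    have h2 := totalDegree_XG_le (n + 2) fun m hm ↦ ih m (by omega)
    have h1 := totalDegree_XG_le (n + 1) fun m hm ↦ ih m (by omega)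
    have h0 := totalDegree_XG_le n fun m hm ↦ ih m (by omega)
    rw [XG_add_six_sub_topXG]
    apply le_trans
    · with_reducible_and_instances repeat' first
        | assumption
        | exact totalDegree_ofNat_le_s8 _
        | exact totalDegree_C_le_s8 _
        | exact totalDegree_X_le_s8 _
        | exact totalDegree_X_pow_le_s8 _ _
        | apply totalDegree_mul_le_add
        | apply totalDegree_add_le_max
        | apply totalDegree_sub_le_max
    · omega

/-- For `n ≥ 5`, the polynomial
`X_n − (x^n − n x^{n−2} y + ((n²−3n)/2) x^{n−4} y² − n x^{n−3} y − 3n x^{n−2})`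
has total degree at most `n − 3`. -/
theorem XG_leading_terms (n : ℕ) (hn : 5 ≤ n) :
    (XG n - (X 0 ^ n - C (n : ℤ) * X 0 ^ (n - 2) * X 1
        + C (((n : ℤ) ^ 2 - 3 * (n : ℤ)) / 2) * X 0 ^ (n - 4) * X 1 ^ 2
        - C (n : ℤ) * X 0 ^ (n - 3) * X 1
        - C (3 * (n : ℤ)) * X 0 ^ (n - 2))).totalDegree
      ≤ n - 3 := by
  obtain ⟨m, rfl⟩ := Nat.exists_eq_add_of_le' hn
  have h := totalDegree_XG_sub_topXG m
  rw [topXG, coeffXG] at h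
  simpa only [Nat.cast_add, Nat.cast_ofNat, Nat.add_sub_cancel,
    Nat.reduceSubDiff] using h
end
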